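/- arXiv:1706.00908 — 2 statements merged into one kernel-verified Lean document; each statement's English description precedes it below -/
import Mathlib

section
/- Let n ≥ 5 be an integer and let δ, ε, ρ̄ be positive reals with δ ≤ ε, nε ≤ 1, and ρ̂·ε² ≤ δ/2, where ρ̂ := 3.05 + 2.1·ρ̄ + 0.6·ρ̄² + 0.01·ρ̄³. Let d_av ∈ (0,1]. Let (η̂_t, ν̂_t, ε̂_t, τ̂_t)_{t≥0} be a sequence of quadruplets of reals with initial values η̂_0 = δ, ν̂_0 = 1−δ, ε̂_0 = ε, τ̂_0 = 0, and suppose that for each t ≥ 0 there exist reals ρ_1,…,ρ_{10} with |ρ_k| ≤ ρ̄ for all k such that, setting η̃_{t+1} = (1−δ)²·[(1+ρ_1 ε²)·η̂_t + ρ_2 ε²·ν̂_t + (2ε+ρ_3 ε²)·ε̂_t + ρ_4 ε·τ̂_t], ν̃_{t+1} = (1−δ)²·[(1+ρ_5 ε²)·η̂_t + (d_av+ρ_6 ε²)·ε̂_t + ρ_7 ε n^{−1/2}·τ̂_t], ε̃_{t+1} = (1−δ)²·ε̂_t, and τ̃_{t+1} = (1−δ)²·[ρ_8 ε n^{−1/2}·η̂_t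 + (ρ_9 n^{−1/2}+ρ_{10} ε²)·ε̂_t], one has η̂_{t+1} = max(η̃_{t+1},0), ν̂_{t+1} = max(ν̃_{t+1},0), ε̂_{t+1} = max(ε̃_{t+1},0), τ̂_{t+1} = max(τ̃_{t+1},0). Define η̄_t := 1.5·ρ̂·(1−1.4δ)^t·t·δ and ε̄_t := (1−1.8δ)^t·ε. Then for all t ≥ 1: 0 ≤ η̂_t ≤ η̄_t; 0 ≤ ε̂_t ≤ ε̄_t; 0 ≤ τ̂_t ≤ 0.5·ε·ρ̄·η̄_t + 0.54·ρ̄·ε̄_t ≤ 0.1·ρ̄·η̄_t + 0.54·ρ̄·ε̄_t; and 0 ≤ ν̂_t ≤ (1.1 + 0.01·ρ̄²)·η̄_t + (1.1 + 0.1·ρ̄²)·ε̄_t. -/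
theorem recs (δ ε ρbar dav s q : ℝ) (n : ℕ) (hs : s = 1 / Real.sqrt n) (hq : q = (1-δ)^2)
    (hε : 0 < ε) (hρbar : 0 < ρbar) (hs0 : 0 ≤ s) (hdav : dav ≤ 1)
    (η ν εh τ : ℕ → ℝ)
    (hrec : ∀ t : ℕ, ∃ ρ : Fin 10 → ℝ, (∀ k, |ρ k| ≤ ρbar) ∧
      η (t+1) = max ((1-δ)^2 * ((1 + ρ 0 * ε^2) * η t + ρ 1 * ε^2 * ν t
                      + (2*ε + ρ 2 * ε^2) * εh t + ρ 3 * ε * τ t)) 0 ∧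
      ν (t+1) = max ((1-δ)^2 * ((1 + ρ 4 * ε^2) * η t + (dav + ρ 5 * ε^2) * εh t
                      + ρ 6 * ε / Real.sqrt n * τ t)) 0 ∧
      εh (t+1) = max ((1-δ)^2 * εh t) 0 ∧
      τ (t+1) = max ((1-δ)^2 * (ρ 7 * ε / Real.sqrt n * η t
                      + (ρ 8 / Real.sqrt n + ρ 9 * ε^2) * εh t)) 0)
    (t : ℕ) (hp : 0 ≤ η t ∧ 0 ≤ ν t ∧ 0 ≤ εh t ∧ 0 ≤ τ t) :
    η (t+1) ≤ q * ((1 + ρbar * ε^2) * η t + ρbar * ε^2 * ν t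
                      + (2*ε + ρbar * ε^2) * εh t + ρbar * ε * τ t) ∧
    ν (t+1) ≤ q * ((1 + ρbar * ε^2) * η t + (1 + ρbar * ε^2) * εh t + ρbar * ε * s * τ t) ∧
    εh (t+1) ≤ q * εh t ∧
    τ (t+1) ≤ q * (ρbar * ε * s * η t + (ρbar * s + ρbar * ε^2) * εh t) := by
  obtain ⟨ρ, hρ, h1, h2, h3, h4⟩ := hrec t
  obtain ⟨p1, p2, p3, p4⟩ := hp
  have hk : ∀ k, ρ k ≤ ρbar := fun k => (le_abs_self _).trans (hρ k)
  have hq0 : 0 ≤ q := by rw [hq]; positivity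
  have e : ∀ x : ℝ, x / Real.sqrt n = x * s := fun x => by rw [hs]; ring
  rw [h1, h2, h3, h4, ← hq, e, e, e]
  refine ⟨max_le ?_ (by positivity), max_le ?_ (by positivity), max_le le_rfl (by positivity),
    max_le ?_ (by positivity)⟩
  · gcongr <;> apply hk
  · gcongr <;> apply hk
  · gcongr <;> apply hk

set_option maxHeartbeats 4000000 in
theorem four_term_recurrence_bounds
    (n : ℕ) (hn : 5 ≤ n) (δ ε ρbar : ℝ)
    (hδ : 0 < δ) (hε : 0 < ε) (hρbar : 0 < ρbar)
    (hδε : δ ≤ ε) (hnε : (n : ℝ) * ε ≤ 1)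
    (ρhat : ℝ) (hρhat : ρhat = 3.05 + 2.1 * ρbar + 0.6 * ρbar^2 + 0.01 * ρbar^3)
    (hsmall : ρhat * ε^2 ≤ δ / 2)
    (dav : ℝ) (hdav : 0 < dav ∧ dav ≤ 1)
    (η ν εh τ : ℕ → ℝ)
    (hη0 : η 0 = δ) (hν0 : ν 0 = 1 - δ) (hε0 : εh 0 = ε) (hτ0 : τ 0 = 0)
    (hrec : ∀ t : ℕ, ∃ ρ : Fin 10 → ℝ, (∀ k, |ρ k| ≤ ρbar) ∧
      η (t+1) = max ((1-δ)^2 * ((1 + ρ 0 * ε^2) * η t + ρ 1 * ε^2 * ν t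
                      + (2*ε + ρ 2 * ε^2) * εh t + ρ 3 * ε * τ t)) 0 ∧
      ν (t+1) = max ((1-δ)^2 * ((1 + ρ 4 * ε^2) * η t + (dav + ρ 5 * ε^2) * εh t
                      + ρ 6 * ε / Real.sqrt n * τ t)) 0 ∧
      εh (t+1) = max ((1-δ)^2 * εh t) 0 ∧
      τ (t+1) = max ((1-δ)^2 * (ρ 7 * ε / Real.sqrt n * η t
                      + (ρ 8 / Real.sqrt n + ρ 9 * ε^2) * εh t)) 0)
    (ηbar εbar : ℕ → ℝ)
    (hηbar : ∀ t : ℕ, ηbar t = 1.5 * ρhat * (1 - 1.4*δ)^t * t * δ)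
    (hεbar : ∀ t : ℕ, εbar t = (1 - 1.8*δ)^t * ε) :
    ∀ t : ℕ, 1 ≤ t →
      (0 ≤ η t ∧ η t ≤ ηbar t) ∧
      (0 ≤ εh t ∧ εh t ≤ εbar t) ∧
      (0 ≤ τ t ∧ τ t ≤ 0.5 * ε * ρbar * ηbar t + 0.54 * ρbar * εbar t ∧
        0.5 * ε * ρbar * ηbar t + 0.54 * ρbar * εbar t
          ≤ 0.1 * ρbar * ηbar t + 0.54 * ρbar * εbar t) ∧
      (0 ≤ ν t ∧ ν t ≤ (1.1 + 0.01 * ρbar^2) * ηbar t + (1.1 + 0.1 * ρbar^2) * εbar t) := by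
  have hn' : (5:ℝ) ≤ n := by exact_mod_cast hn
  have he5 : ε ≤ 1/5 := by nlinarith
  have hd5 : δ ≤ 1/5 := by linarith
  obtain ⟨s, hs⟩ : ∃ s : ℝ, s = 1 / Real.sqrt n := ⟨_, rfl⟩
  have hsq : 2.23 ≤ Real.sqrt n := Real.le_sqrt_of_sq_le (by norm_num; linarith)
  have he2 : ε^2 ≤ 0.04 := by nlinarith only [hε, he5]
  have hs0 : 0 ≤ s := by rw [hs]; positivity
  have hs1 : s ≤ 0.45 := by
    rw [hs, div_le_iff₀ (by linarith)]; linarith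
  obtain ⟨q, hq⟩ : ∃ q : ℝ, q = (1-δ)^2 := ⟨_, rfl⟩
  have hq0 : 0 ≤ q := by rw [hq]; positivity
  have hq1 : q ≤ 1 - 1.8*δ := by rw [hq]; nlinarith
  have hq2 : q * (1 + δ/2) ≤ 1 - 1.4*δ := by
    rw [hq]; nlinarith [mul_nonneg hδ.le (sub_nonneg.2 hd5), mul_nonneg (mul_nonneg hδ.le hδ.le) (sub_nonneg.2 hd5)]
  have hR : 3.05 ≤ ρhat := by rw [hρhat]; linarith [pow_pos hρbar 2, pow_pos hρbar 3]
  have hre : ρbar * ε^2 ≤ 0.05 := by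
    have : 2.1 * ρbar * ε^2 ≤ ρhat * ε^2 := by
      apply mul_le_mul_of_nonneg_right _ (by positivity)
      rw [hρhat]; linarith [pow_pos hρbar 2, pow_pos hρbar 3]
    nlinarith
  have hmul : ∀ r x : ℝ, |r| ≤ ρbar → 0 ≤ x → r * x ≤ ρbar * x := fun r x hr hx =>
    mul_le_mul_of_nonneg_right ((le_abs_self r).trans hr) hx
  have key := recs δ ε ρbar dav s q n hs hq hε hρbar hs0 hdav.2 η ν εh τ hrec
  have hpos : ∀ t, 0 ≤ η t ∧ 0 ≤ ν t ∧ 0 ≤ εh t ∧ 0 ≤ τ t := by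
    intro t
    rcases t with _ | t
    · rw [hη0, hν0, hε0, hτ0]; refine ⟨hδ.le, by linarith, hε.le, le_rfl⟩
    · obtain ⟨ρ, -, h1, h2, h3, h4⟩ := hrec t
      rw [h1, h2, h3, h4]
      exact ⟨le_max_right _ _, le_max_right _ _, le_max_right _ _, le_max_right _ _⟩
  have hH0 : ∀ t, 0 ≤ ηbar t := by
    intro t; rw [hηbar]
    have : 0 ≤ 1 - 1.4*δ := by linarith
    positivity
  have hE0 : ∀ t, 0 ≤ εbar t := by
    intro t; rw [hεbar]
    have : 0 ≤ 1 - 1.8*δ := by linarith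
    positivity
  have hE1 : ∀ t, εbar (t+1) = (1 - 1.8*δ) * εbar t := by
    intro t; rw [hεbar, hεbar]; ring
  have hH1 : ∀ t, ηbar (t+1) = (1 - 1.4*δ) * ηbar t + 1.5 * ρhat * δ * (1 - 1.4*δ)^(t+1) := by
    intro t; rw [hηbar, hηbar]; push_cast; ring
  have hEq : ∀ t, q * εbar t ≤ εbar (t+1) := fun t => by
    rw [hE1]; exact mul_le_mul_of_nonneg_right hq1 (hE0 t)
  have main : ∀ t : ℕ, 1 ≤ t → η t ≤ ηbar t ∧ εh t ≤ εbar t ∧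
      τ t ≤ 0.5 * ε * ρbar * ηbar t + 0.54 * ρbar * εbar t ∧
      ν t ≤ (1.1 + 0.01 * ρbar^2) * ηbar t + (1.1 + 0.1 * ρbar^2) * εbar t := by
    intro t ht
    induction t, ht using Nat.le_induction with
    | base =>
      obtain ⟨k1, k2, k3, k4⟩ := key 0 (hpos 0)
      rw [hη0, hν0, hε0, hτ0] at k1
      rw [hη0, hε0, hτ0] at k2
      rw [hε0] at k3
      rw [hη0, hε0] at k4
      have hE : q * ε ≤ εbar 1 := by have := hEq 0; rw [hεbar 0] at this; simpa using this
      have hH : q * (1.5 * ρhat * δ) ≤ ηbar 1 := by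
        rw [hηbar]; norm_num
        have : q ≤ 1 - 1.4*δ := by linarith
        linarith [mul_le_mul_of_nonneg_right this (show 0 ≤ 1.5 * ρhat * δ by positivity)]
      have hD : q * (1.5 * δ) * 3.05 ≤ ηbar 1 := by
        refine le_trans ?_ hH
        linarith [mul_nonneg hq0 (mul_nonneg hδ.le (sub_nonneg.2 hR))]
      have hqd : 0 ≤ q * δ := by positivity
      have hqe : 0 ≤ q * ε := by positivity
      refine ⟨?_, ?_, ?_, ?_⟩
      · refine k1.trans (le_trans ?_ hD)
        have : (1 + ρbar * ε^2) * δ + ρbar * ε^2 * (1-δ) + (2*ε + ρbar * ε^2) * ε + ρbar * ε * 0 ≤ 1.5 * δ := by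
          have h1 : ρbar * ε^2 * ε ≤ ρbar * ε^2 * (1/5) := mul_le_mul_of_nonneg_left he5 (by positivity)
          have h2 : (2 + 1.2 * ρbar) * ε^2 ≤ ρhat * ε^2 := by
            apply mul_le_mul_of_nonneg_right _ (by positivity)
            rw [hρhat]; linarith [pow_pos hρbar 2, pow_pos hρbar 3]
          linarith
        have := mul_le_mul_of_nonneg_left this hq0
        linarith
      · exact k3.trans hE
      · refine k4.trans ?_
        have a1 : q * (ρbar * ε * s * δ) ≤ 0.5 * ε * ρbar * ηbar 1 := by
          have : q * δ * s ≤ 0.5 * ηbar 1 := by linarith [mul_le_mul_of_nonneg_left hs1 hqd]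
          have := mul_le_mul_of_nonneg_left this (mul_pos hρbar hε).le
          linarith
        have a2 : q * ((ρbar * s + ρbar * ε^2) * ε) ≤ 0.54 * ρbar * εbar 1 := by
          have b : s + ε^2 ≤ 0.54 := by linarith
          have := mul_le_mul_of_nonneg_left (mul_le_mul b hE hqe (by norm_num)) hρbar.le
          linarith
        linarith
      · refine k2.trans ?_
        have a1 : q * ((1 + ρbar * ε^2) * δ) ≤ 1.1 * ηbar 1 := by linarith [mul_le_mul_of_nonneg_left hre hqd]
        have a2 : q * ((1 + ρbar * ε^2) * ε) ≤ 1.1 * εbar 1 := by linarith [mul_le_mul_of_nonneg_left hre hqe]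
        linarith [mul_nonneg (sq_nonneg ρbar) (hH0 1), mul_nonneg (sq_nonneg ρbar) (hE0 1)]
    | succ t ht ih =>
      obtain ⟨i1, i2, i3, i4⟩ := ih
      obtain ⟨k1, k2, k3, k4⟩ := key t (hpos t)
      have hE := hEq t
      have hHt := hH0 t
      have hEt := hE0 t
      have hHs := hH1 t
      have hX : 0 ≤ 1.5 * ρhat * δ * (1 - 1.4*δ)^(t+1) := by
        have : 0 ≤ 1 - 1.4*δ := by linarith
        positivity
      have hH : q * ηbar t ≤ ηbar (t+1) := by
        have : q ≤ 1 - 1.4*δ := by linarith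
        linarith [mul_le_mul_of_nonneg_right this hHt]
      have hr2 := sq_nonneg ρbar
      have hqH : 0 ≤ q * ηbar t := by positivity
      have hqE : 0 ≤ q * εbar t := by positivity
      refine ⟨?_, ?_, ?_, ?_⟩
      · refine k1.trans ?_
        have c1 : (1 + ρbar * ε^2) * η t + ρbar * ε^2 * ν t + (2*ε + ρbar * ε^2) * εh t + ρbar * ε * τ t
           ≤ (1 + ρbar * ε^2) * ηbar t + ρbar * ε^2 * ((1.1 + 0.01 * ρbar^2) * ηbar t + (1.1 + 0.1 * ρbar^2) * εbar t) + (2*ε + ρbar * ε^2) * εbar t + ρbar * ε * (0.5 * ε * ρbar * ηbar t + 0.54 * ρbar * εbar t) := by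
          gcongr
        have c2 : 1 + ε^2 * (2.1 * ρbar + 0.01 * ρbar^3 + 0.5 * ρbar^2) ≤ 1 + δ/2 := by
          have : ε^2 * (2.1 * ρbar + 0.01 * ρbar^3 + 0.5 * ρbar^2) ≤ ε^2 * ρhat := by
            apply mul_le_mul_of_nonneg_left _ (by positivity)
            rw [hρhat]; linarith [pow_pos hρbar 2, pow_pos hρbar 3]
          linarith
        have c3 : (2*ε + ε^2 * (2.1 * ρbar + 0.1 * ρbar^3) + 0.54 * ρbar^2 * ε) * ε ≤ 1.5 * ρhat * δ := by
          have p3 : 0 < ρbar^3 := by positivity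
          have d1 : ε * (2.1 * ρbar + 0.1 * ρbar^3) ≤ 1/5 * (2.1 * ρbar + 0.1 * ρbar^3) :=
            mul_le_mul_of_nonneg_right he5 (by positivity)
          have d2 : 2 + ε * (2.1 * ρbar + 0.1 * ρbar^3) + 0.54 * ρbar^2 ≤ 2 * ρhat := by
            rw [hρhat]; linarith [pow_pos hρbar 2, pow_pos hρbar 3]
          have d3 := mul_le_mul_of_nonneg_right d2 (sq_nonneg ε)
          have d4 : δ ≤ 1.5 * ρhat * δ := by nlinarith only [hδ, hR]
          linarith
        have c4 : q * (1 + δ/2) * ηbar t ≤ (1 - 1.4*δ) * ηbar t := mul_le_mul_of_nonneg_right hq2 hHt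
        have c5 : q * (1-1.8*δ)^t ≤ (1 - 1.4*δ)^(t+1) := by
          have z : 0 ≤ 1 - 1.8*δ := by linarith
          calc q * (1-1.8*δ)^t ≤ (1-1.8*δ) * (1-1.8*δ)^t := by gcongr
            _ = (1-1.8*δ)^(t+1) := by ring
            _ ≤ _ := by gcongr; norm_num
        have c6 : q * ((2*ε + ε^2 * (2.1 * ρbar + 0.1 * ρbar^3) + 0.54 * ρbar^2 * ε) * εbar t) ≤ 1.5 * ρhat * δ * (1 - 1.4*δ)^(t+1) := by
          have z : 0 ≤ 1 - 1.8*δ := by linarith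
          have := mul_le_mul c3 c5 (by positivity) (by positivity)
          rw [hεbar]; linarith
        have c7 := mul_le_mul_of_nonneg_left c1 hq0
        have c8 := mul_le_mul_of_nonneg_right c2 hqH
        rw [hHs]
        linarith
      · exact k3.trans ((mul_le_mul_of_nonneg_left i2 hq0).trans hE)
      · refine k4.trans ?_
        have c1 : ρbar * ε * s * η t + (ρbar * s + ρbar * ε^2) * εh t ≤ ρbar * ε * s * ηbar t + (ρbar * s + ρbar * ε^2) * εbar t := by gcongr
        have c7 := mul_le_mul_of_nonneg_left c1 hq0
        have a1 : q * (ρbar * ε * s * ηbar t) ≤ 0.5 * ε * ρbar * ηbar (t+1) := by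
          have := mul_le_mul_of_nonneg_left (mul_le_mul (show s ≤ 0.5 by linarith) hH hqH (by norm_num)) (mul_pos hρbar hε).le
          linarith
        have a2 : q * ((ρbar * s + ρbar * ε^2) * εbar t) ≤ 0.54 * ρbar * εbar (t+1) := by
          have b : s + ε^2 ≤ 0.54 := by linarith
          have := mul_le_mul_of_nonneg_left (mul_le_mul b hE hqE (by norm_num)) hρbar.le
          linarith
        linarith
      · refine k2.trans ?_
        have c1 : (1 + ρbar * ε^2) * η t + (1 + ρbar * ε^2) * εh t + ρbar * ε * s * τ t ≤ (1 + ρbar * ε^2) * ηbar t + (1 + ρbar * ε^2) * εbar t + ρbar * ε * s * (0.5 * ε * ρbar * ηbar t + 0.54 * ρbar * εbar t) := by gcongr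
        have c7 := mul_le_mul_of_nonneg_left c1 hq0
        have a1 : (1 + ρbar * ε^2 + ρbar^2 * (0.5 * ε^2 * s)) ≤ 1.1 + 0.01 * ρbar^2 := by
          have : 0.5 * ε^2 * s ≤ 0.01 := by nlinarith only [mul_le_mul he2 hs1 hs0 (by norm_num)]
          linarith [mul_le_mul_of_nonneg_left this hr2]
        have a2 : (1 + ρbar * ε^2 + ρbar^2 * (0.54 * ε * s)) ≤ 1.1 + 0.1 * ρbar^2 := by
          have : 0.54 * ε * s ≤ 0.1 := by nlinarith only [mul_le_mul he5 hs1 hs0 (by norm_num)]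
          linarith [mul_le_mul_of_nonneg_left this hr2]
        have b1 := mul_le_mul a1 hH hqH (by positivity)
        have b2 := mul_le_mul a2 hE hqE (by positivity)
        linarith
  intro t ht
  obtain ⟨m1, m2, m3, m4⟩ := main t ht
  obtain ⟨p1, p2, p3, p4⟩ := hpos t
  refine ⟨⟨p1, m1⟩, ⟨p3, m2⟩, ⟨p4, m3, ?_⟩, p2, m4⟩
  linarith [mul_nonneg (mul_nonneg (sub_nonneg.2 he5) hρbar.le) (hH0 t)]
end

section
/- There exists an absolute constant C > 0 with the following property. Let n ≥ 3 be an integer and let δ, ε be reals with 0 < δ ≤ ε and nε ≤ 1; let D be an n×n diagonal matrix with all diagonal entries in [0,1]; let P be any n×n permutation matrix and set D_P := P^T D P. Let E be the strictly lower triangular n×n matrix of all ones below the diagonal, let F be the n×n matrix with F_{i,i+1} = 1 for i = 1,…,n−1 and all other entries 0, and define C_P := −(1−δ)·[(1−δ)E + I + εD_P]^{−1}·E^T. Then, in the spectral (operator 2-) norm, ‖(1−δ)^{−1}·C_P − [ I − e₁𝟏^T + ε·(−D_P + F^T D_P)(I − e₁𝟏^T) + δ·(F^T − e₂𝟏^T)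 ]‖ ≤ C·ε²·(1 + √n). -/
open Matrix

/-- The strictly lower triangular matrix of all ones below the diagonal. -/
def matE (n : ℕ) : Matrix (Fin n) (Fin n) ℝ :=
  Matrix.of fun i j => if (j : ℕ) < (i : ℕ) then 1 else 0

/-- The matrix with ones on the superdiagonal. -/
def matF (n : ℕ) : Matrix (Fin n) (Fin n) ℝ :=
  Matrix.of fun i j => if (i : ℕ) + 1 = (j : ℕ) then 1 else 0

/-- The permutation matrix `P` of `σ`, satisfying `P e_j = e_{σ j}`. -/
def permMat {n : ℕ} (σ : Equiv.Perm (Fin n)) : Matrix (Fin n) (Fin n) ℝ :=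
  Matrix.of fun i j => if i = σ j then 1 else 0


section aux
open scoped Matrix.Norms.L2Operator

lemma aux_Ft_mul {n : ℕ} (B : Matrix (Fin n) (Fin n) ℝ) (i j : Fin n) :
    ((matF n)ᵀ * B) i j = if 0 < (i : ℕ) then B ⟨(i : ℕ) - 1, by omega⟩ j else 0 := by
  rw [Matrix.mul_apply]
  split_ifs with h
  · rw [Finset.sum_eq_single (⟨(i : ℕ) - 1, by omega⟩ : Fin n)]
    · have : (i : ℕ) - 1 + 1 = i := by omega
      simp [matF, this]
    · intro b _ hb
      have : ¬ ((b : ℕ) + 1 = i) := by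
        intro h'
        apply hb
        ext
        simp
        omega
      simp [matF, this]
    · simp
  · apply Finset.sum_eq_zero
    intro b _
    have : ¬ ((b : ℕ) + 1 = i) := by omega
    simp [matF, this]

lemma aux_FtE (n : ℕ) : (matF n)ᵀ * matE n = matE n - (matF n)ᵀ := by
  ext i j
  rw [aux_Ft_mul]
  simp only [matE, matF, Matrix.sub_apply, Matrix.transpose_apply, Matrix.of_apply]
  split_ifs <;> first | omega | norm_num

lemma aux_FtEt (n : ℕ) (hn : 0 < n) : (matF n)ᵀ * (matE n)ᵀ =
    (matE n)ᵀ + (1 - Matrix.vecMulVec (Pi.single ⟨0, hn⟩ 1) (fun _ => 1)) := by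
  ext i j
  rw [aux_Ft_mul]
  simp only [matE, Matrix.add_apply, Matrix.sub_apply, Matrix.transpose_apply, Matrix.of_apply,
    Matrix.vecMulVec_apply, Pi.single_apply, Matrix.one_apply, Fin.ext_iff]
  split_ifs <;> first | omega | norm_num

lemma aux_Fte1 (n : ℕ) (hn0 : 0 < n) (hn : 1 < n) :
    (matF n)ᵀ * Matrix.vecMulVec (Pi.single ⟨0, hn0⟩ 1) (fun _ => 1) =
    Matrix.vecMulVec (Pi.single ⟨1, hn⟩ 1) (fun _ : Fin n => (1 : ℝ)) := by
  ext i j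
  rw [aux_Ft_mul]
  simp only [Matrix.vecMulVec_apply, Pi.single_apply, Fin.ext_iff]
  split_ifs <;> first | omega | norm_num

lemma aux_diag_norm {n : ℕ} (v : Fin n → ℝ) (c : ℝ) (hc : 0 ≤ c) (h : ∀ i, |v i| ≤ c) :
    ‖(Matrix.diagonal v : Matrix (Fin n) (Fin n) ℝ)‖ ≤ c := by
  rw [Matrix.l2_opNorm_diagonal]
  exact (pi_norm_le_iff_of_nonneg hc).2 h

lemma aux_Ft_norm (n : ℕ) : ‖(matF n)ᵀ‖ ≤ 1 := by
  have h : (matF n)ᵀ * (matF n) =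
      Matrix.diagonal (fun i : Fin n => if 0 < (i : ℕ) then (1 : ℝ) else 0) := by
    ext i j
    rw [aux_Ft_mul]
    simp only [matF, Matrix.of_apply, Matrix.diagonal_apply, Fin.ext_iff]
    split_ifs <;> first | omega | norm_num
  have h2 := Matrix.l2_opNorm_conjTranspose_mul_self (matF n)
  rw [Matrix.conjTranspose_eq_transpose_of_trivial, h] at h2
  have h3 := Matrix.l2_opNorm_conjTranspose (matF n)
  rw [Matrix.conjTranspose_eq_transpose_of_trivial] at h3
  have h4 := aux_diag_norm (fun i : Fin n => if 0 < (i : ℕ) then (1 : ℝ) else 0) 1 zero_le_one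
    (by intro i; split_ifs <;> simp)
  rw [h3]
  nlinarith [norm_nonneg (matF n)]

lemma aux_one_norm (n : ℕ) : ‖(1 : Matrix (Fin n) (Fin n) ℝ)‖ ≤ 1 := by
  rw [← Matrix.diagonal_one]
  exact aux_diag_norm _ 1 zero_le_one (by simp)

lemma aux_e1_norm (n : ℕ) (i0 : Fin n) :
    ‖Matrix.vecMulVec (Pi.single i0 1) (fun _ : Fin n => (1 : ℝ))‖ ≤ Real.sqrt n := by
  set V := Matrix.vecMulVec (Pi.single i0 1) (fun _ : Fin n => (1 : ℝ)) with hV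
  have h : V * Vᵀ = Matrix.diagonal (fun i : Fin n => if i = i0 then (n : ℝ) else 0) := by
    ext i j
    simp only [hV, Matrix.mul_apply, Matrix.transpose_apply, Matrix.vecMulVec_apply,
      Pi.single_apply, Matrix.diagonal_apply]
    by_cases h1 : i = i0 <;> by_cases h2 : j = i0 <;> by_cases h3 : i = j <;> simp_all
  have h2 := Matrix.l2_opNorm_conjTranspose_mul_self (Vᵀ)
  have h3 := Matrix.l2_opNorm_conjTranspose V
  rw [Matrix.conjTranspose_eq_transpose_of_trivial] at h3
  rw [Matrix.conjTranspose_eq_transpose_of_trivial, Matrix.transpose_transpose, h, h3] at h2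
  have h4 := aux_diag_norm (fun i : Fin n => if i = i0 then (n : ℝ) else 0) n (by positivity)
    (by intro i; split_ifs <;> simp)
  apply Real.le_sqrt_of_sq_le
  nlinarith

lemma aux_DP {n : ℕ} (σ : Equiv.Perm (Fin n)) (d : Fin n → ℝ) :
    (permMat σ)ᵀ * Matrix.diagonal d * permMat σ = Matrix.diagonal (fun i => d (σ i)) := by
  ext i j
  rw [Matrix.mul_apply]
  simp only [Matrix.mul_diagonal, permMat, Matrix.transpose_apply, Matrix.of_apply,
    Matrix.diagonal_apply]
  rw [Finset.sum_eq_single (σ j)]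
  · by_cases h : i = j
    · simp [h]
    · have : ¬ (σ j = σ i) := fun h' => h (σ.injective h').symm
      simp [h, this]
  · intro b _ hb
    simp [hb]
  · simp

lemma aux_det {n : ℕ} (δ ε : ℝ) (hε : 0 ≤ ε) (v : Fin n → ℝ) (hv : ∀ i, 0 ≤ v i) :
    IsUnit ((1 - δ) • matE n + 1 + ε • Matrix.diagonal v).det := by
  rw [Matrix.det_of_isLowerTriangular]
  · rw [isUnit_iff_ne_zero]
    apply Finset.prod_ne_zero_iff.2
    intro i _
    have : 0 ≤ ε * v i := mul_nonneg hε (hv i)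
    simp [matE]
    linarith
  · intro i j hij
    have hij' : i < j := by simpa using hij
    simp [matE, hij'.ne, not_lt.2 hij'.le]

lemma aux_main (n : ℕ) (hn : 3 ≤ n) (hn0 : 0 < n) (δ ε : ℝ) (hδ : 0 < δ) (hδε : δ ≤ ε) (hnε : (n : ℝ) * ε ≤ 1)
    (v : Fin n → ℝ) (hv : ∀ i, 0 ≤ v i ∧ v i ≤ 1)
    (D F E A M X : Matrix (Fin n) (Fin n) ℝ) (hD : D = Matrix.diagonal v)
    (hF : F = (matF n)ᵀ) (hE : E = matE n)
    (hA : A = 1 - Matrix.vecMulVec (Pi.single ⟨0, hn0⟩ 1) (fun _ => 1))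
    (hM : M = (1 - δ) • E + 1 + ε • D)
    (hX : X = -(M⁻¹ * Eᵀ) - (A + ε • ((-D + F * D) * A) + δ • (F * A))) :
    ‖X‖ ≤ 27 * ε ^ 2 * (1 + Real.sqrt n) := by
  have hε : 0 < ε := hδ.trans_le hδε
  have h3 : 3 * ε ≤ 1 := by
    have : (3 : ℝ) ≤ n := by exact_mod_cast hn
    nlinarith
  have hMu : M * M⁻¹ = 1 := by
    apply Matrix.mul_nonsing_inv
    rw [hM, hE, hD]
    exact aux_det δ ε hε.le v (fun i => (hv i).1)
  have hFn : ‖F‖ ≤ 1 := hF ▸ aux_Ft_norm n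
  have hFE : F * E = E - F := by rw [hF, hE, aux_FtE]
  have hFEt : F * Eᵀ = Eᵀ + A := by rw [hF, hE, hA, aux_FtEt n hn0]
  have hAn : ‖A‖ ≤ 1 + Real.sqrt n := by
    rw [hA]
    exact (norm_sub_le _ _).trans (add_le_add (aux_one_norm n) (aux_e1_norm n _))
  have hDn : ‖D‖ ≤ 1 := by
    rw [hD]
    exact aux_diag_norm _ _ zero_le_one
      (fun i => abs_le.2 ⟨by linarith [(hv i).1], (hv i).2⟩)
  set K : Matrix (Fin n) (Fin n) ℝ := δ • F - ε • D + ε • (F * D) with hK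
  have hFDn : ‖F * D‖ ≤ 1 := (norm_mul_le _ _).trans (mul_le_one₀ hFn (norm_nonneg _) hDn)
  have s1 : ‖δ • F‖ ≤ ε := by
    rw [norm_smul, Real.norm_of_nonneg hδ.le]
    nlinarith [norm_nonneg F]
  have s2 : ‖ε • D‖ ≤ ε := by
    rw [norm_smul, Real.norm_of_nonneg hε.le]
    nlinarith
  have s3 : ‖ε • (F * D)‖ ≤ ε := by
    rw [norm_smul, Real.norm_of_nonneg hε.le]
    nlinarith
  have hKn : ‖K‖ ≤ 3 * ε := by
    have := norm_add_le (δ • F - ε • D) (ε • (F * D))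
    have := norm_sub_le (δ • F) (ε • D)
    rw [hK]
    linarith
  have hLM : (1 - F) * M = 1 - K := by
    have : (1 - F) * M = (1 - δ) • (E - F * E) + (1 - F) + ε • (D - F * D) := by
      rw [hM]
      simp only [Matrix.mul_add, Matrix.sub_mul, Matrix.mul_smul, Matrix.one_mul, Matrix.mul_one,
        smul_sub]
    rw [this, hFE, hK]
    module
  have hNY : (1 - K) * (-(M⁻¹ * Eᵀ)) = A := by
    rw [← hLM, Matrix.mul_neg, Matrix.mul_assoc, ← Matrix.mul_assoc M, hMu, Matrix.one_mul,
      Matrix.sub_mul, hFEt, Matrix.one_mul]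
    abel
  have hXK : X = -(M⁻¹ * Eᵀ) - (1 + K) * A := by
    rw [hX, hK]
    simp only [Matrix.add_mul, Matrix.sub_mul, Matrix.neg_mul, Matrix.smul_mul, Matrix.one_mul]
    module
  have hNX : (1 - K) * X = K * K * A := by
    rw [hXK, Matrix.mul_sub, hNY]
    noncomm_ring
  have hKKA : ‖K * K * A‖ ≤ 9 * ε ^ 2 * (1 + Real.sqrt n) := by
    refine (norm_mul_le _ _).trans (mul_le_mul ?_ hAn (norm_nonneg _) (by positivity))
    refine (norm_mul_le _ _).trans ?_
    nlinarith [norm_nonneg K]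
  set R : Matrix (Fin n) (Fin n) ℝ := Matrix.diagonal (fun i => (1 + ε * v i)⁻¹) with hR
  have hpos : ∀ i, 1 ≤ 1 + ε * v i := fun i => by
    have := mul_nonneg hε.le (hv i).1
    linarith
  have hRn : ‖R‖ ≤ 1 := by
    refine aux_diag_norm _ _ zero_le_one (fun i => ?_)
    have := hpos i
    rw [abs_of_nonneg (by positivity)]
    exact inv_le_one_of_one_le₀ this
  have hRD : R * (1 + ε • D) = 1 := by
    ext i j
    have := hpos i
    by_cases h : i = j
    · subst h
      simp [hR, hD, Matrix.diagonal_mul]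
      field_simp
    · simp [hR, hD, Matrix.diagonal_mul, h]
  have hX2 : X = R * (K * K * A + (δ • F + ε • (F * D)) * X) := by
    have : K * K * A + (δ • F + ε • (F * D)) * X = (1 + ε • D) * X := by
      rw [← hNX, ← Matrix.add_mul, hK]
      congr 1
      abel
    rw [this, ← Matrix.mul_assoc, hRD, Matrix.one_mul]
  have hG : ‖δ • F + ε • (F * D)‖ ≤ 2 / 3 := by
    have := norm_add_le (δ • F) (ε • (F * D))
    linarith
  have hb : ‖X‖ ≤ ‖K * K * A‖ + 2 / 3 * ‖X‖ := by
    calc ‖X‖ = ‖R * (K * K * A + (δ • F + ε • (F * D)) * X)‖ := congrArg _ hX2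
      _ ≤ ‖R‖ * ‖K * K * A + (δ • F + ε • (F * D)) * X‖ := norm_mul_le _ _
      _ ≤ 1 * ‖K * K * A + (δ • F + ε • (F * D)) * X‖ := by gcongr
      _ ≤ ‖K * K * A‖ + ‖(δ • F + ε • (F * D)) * X‖ := by rw [one_mul]; exact norm_add_le _ _
      _ ≤ ‖K * K * A‖ + ‖δ • F + ε • (F * D)‖ * ‖X‖ := by gcongr; exact norm_mul_le _ _
      _ ≤ _ := by gcongr
  linarith

end aux

theorem epoch_matrix_estimate :
    ∃ C : ℝ, 0 < C ∧
      ∀ (n : ℕ) (hn : 3 ≤ n) (δ ε : ℝ), 0 < δ → δ ≤ ε → (n : ℝ) * ε ≤ 1 →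
      ∀ (d : Fin n → ℝ), (∀ i, 0 ≤ d i ∧ d i ≤ 1) →
      ∀ (σ : Equiv.Perm (Fin n)),
      let P := permMat σ
      let DP := Pᵀ * Matrix.diagonal d * P
      let E := matE n
      let F := matF n
      let CP := (-(1 - δ)) • (((1 - δ) • E + 1 + ε • DP)⁻¹ * Eᵀ)
      let e1 : Fin n → ℝ := Pi.single ⟨0, by omega⟩ 1
      let e2 : Fin n → ℝ := Pi.single ⟨1, by omega⟩ 1
      let ones : Fin n → ℝ := fun _ => 1
      ‖Matrix.toEuclideanCLM (𝕜 := ℝ) (n := Fin n)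
          ((1 - δ)⁻¹ • CP -
            (1 - Matrix.vecMulVec e1 ones
              + ε • ((-DP + Fᵀ * DP) * (1 - Matrix.vecMulVec e1 ones))
              + δ • (Fᵀ - Matrix.vecMulVec e2 ones)))‖
        ≤ C * ε^2 * (1 + Real.sqrt n) := by
  refine ⟨27, by norm_num, ?_⟩
  intro n hn δ ε hδ hδε hnε d hd σ
  dsimp only
  have hδ1 : 1 - δ ≠ 0 := by
    have : (3 : ℝ) ≤ n := by exact_mod_cast hn
    nlinarith
  have key := aux_main n hn (by omega) δ ε hδ hδε hnε (fun i => d (σ i)) (fun i => hd (σ i))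
    _ _ _ _ _ _ rfl rfl rfl rfl rfl rfl
  rw [Matrix.l2_opNorm_def] at key
  rw [aux_DP]
  rw [Matrix.mul_sub (matF n)ᵀ, Matrix.mul_one, aux_Fte1 n (by omega) (by omega)] at key
  rw [smul_smul, mul_neg, inv_mul_cancel₀ hδ1, neg_one_smul]
  exact key
end
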